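/- Let W_S be the Coxeter group of type B_n with n ≥ 3 and generators s_1,…,s_n, and let X = {s_1} ∪ Z where Z is a nonempty subset of {s_3,…,s_n} whose induced Coxeter graph is connected. Then the pair (W_X, W_S) satisfies Property ⋆_W, and consequently the standard parabolic subgroup A_X is conjugacy stable in the Artin-Tits group A_S of type B_n. -/

import Mathlib

namespace ArtinTits

variable {B : Type*}

/-- The alternating product `a b a b ⋯` with `m` factors, starting with `a`. -/
def altProd {G : Type*} [Monoid G] (a b : G) : ℕ → G
  | 0 => 1
  | n + 1 => a * altProd b a n

/-- The braid relations defining the Artin–Tits group of a Coxeter matrix: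
`Π(σ_s, σ_t; m_{s,t}) = Π(σ_t, σ_s; m_{s,t})` whenever `m_{s,t} ≠ ∞` (here `∞` is coded by `0`). -/
def artinRelationsSet (M : CoxeterMatrix B) : Set (FreeGroup B) :=
  {r | ∃ s t : B, M s t ≠ 0 ∧
    r = altProd (FreeGroup.of s) (FreeGroup.of t) (M s t) *
        (altProd (FreeGroup.of t) (FreeGroup.of s) (M s t))⁻¹}

/-- The Artin–Tits group of a Coxeter matrix. -/
abbrev ArtinGroup (M : CoxeterMatrix B) : Type _ := PresentedGroup (artinRelationsSet M)

/-- The standard generator `σ_s` of the Artin–Tits group. -/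
def σ (M : CoxeterMatrix B) (s : B) : ArtinGroup M := PresentedGroup.of s

/-- The standard parabolic subgroup `A_X` of the Artin–Tits group. -/
def AP (M : CoxeterMatrix B) (X : Set B) : Subgroup (ArtinGroup M) :=
  Subgroup.closure (σ M '' X)

/-- The standard parabolic subgroup `W_X` of the Coxeter group. -/
def WP (M : CoxeterMatrix B) (X : Set B) : Subgroup M.Group :=
  Subgroup.closure (M.simple '' X)

/-- A subgroup `H ≤ G` is conjugacy stable if any two elements of `H` which are conjugate
in `G` are already conjugate by an element of `H`. -/
def IsConjugacyStable {G : Type*} [Group G] (H : Subgroup G) : Prop :=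
  ∀ a b : G, a ∈ H → b ∈ H → (∃ g : G, g⁻¹ * a * g = b) → ∃ h ∈ H, h⁻¹ * a * h = b

/-- Property `⋆_W` for the pair `(W_X, W_S)`. -/
def StarW (M : CoxeterMatrix B) (X : Set B) : Prop :=
  ∀ Y₁ Y₂ : Set B, Y₁ ⊆ X → Y₂ ⊆ X → ∀ w : M.Group,
    (fun x => w⁻¹ * x * w) '' (M.simple '' Y₁) = M.simple '' Y₂ →
    ∃ v ∈ WP M X, ∀ y ∈ Y₁, v⁻¹ * M.simple y * v = w⁻¹ * M.simple y * w

/-- Property `⋆_A` for the pair `(A_X, A_S)`. -/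
def StarA (M : CoxeterMatrix B) (X : Set B) : Prop :=
  ∀ Y₁ Y₂ : Set B, Y₁ ⊆ X → Y₂ ⊆ X → ∀ g : ArtinGroup M,
    (fun x => g⁻¹ * x * g) '' (σ M '' Y₁) = σ M '' Y₂ →
    ∃ h ∈ AP M X, ∀ y ∈ Y₁, h⁻¹ * σ M y * h = g⁻¹ * σ M y * g

/-- Adjacency in the Coxeter graph: `s` and `t` are joined by an edge iff `m_{s,t} ≥ 3`
(where the value `0` codes `∞`, which also gives an edge). -/
def Adj (M : CoxeterMatrix B) (s t : B) : Prop := s ≠ t ∧ M s t ≠ 2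

/-- `s` and `t` are connected by a path of the Coxeter graph staying inside `X`. -/
def ReachIn (M : CoxeterMatrix B) (X : Set B) (s t : B) : Prop :=
  Relation.ReflTransGen (fun a b => a ∈ X ∧ b ∈ X ∧ Adj M a b) s t

/-- The Coxeter graph induced on `X` is connected. -/
def ConnectedIn (M : CoxeterMatrix B) (X : Set B) : Prop :=
  ∀ s ∈ X, ∀ t ∈ X, ReachIn M X s t

/-- The Coxeter matrix `M` restricted to `X` is of the type of the Coxeter matrix `M'`,
i.e. there is a bijection transporting one to the other. -/
def IsOfType {B' : Type*} (M : CoxeterMatrix B) (X : Set B) (M' : CoxeterMatrix B') : Prop :=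
  ∃ e : X ≃ B', ∀ a b : X, M a.val b.val = M' (e a) (e b)

/-- The Coxeter matrix of type `Bₙ` with the paper's labelling: vertices `0, …, n-1`
(representing `s_1, …, s_n`), `m_{s_1, s_2} = 4` and `m_{s_i, s_{i+1}} = 3` for `i ≥ 2`. -/
def Bmat (n : ℕ) : CoxeterMatrix (Fin n) where
  M := Matrix.of fun i j : Fin n ↦
    if i = j then 1
      else (if (i.val = 0 ∧ j.val = 1) ∨ (j.val = 0 ∧ i.val = 1) then 4
        else (if (j : ℕ) + 1 = i ∨ (i : ℕ) + 1 = j then 3 else 2))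
  isSymm := by unfold Matrix.IsSymm; aesop
  diagonal := by simp
  off_diagonal := by aesop

/-- The Coxeter matrix of type `Dₙ` with the paper's labelling: vertices `0, …, n-1`
(representing `s_1, …, s_n`), with edges `{s_1, s_3}`, `{s_2, s_3}` and `{s_i, s_{i+1}}`
for `i ≥ 3`, all labelled `3`. -/
def Dmat (n : ℕ) : CoxeterMatrix (Fin n) where
  M := Matrix.of fun i j : Fin n ↦
    if i = j then 1
      else (if (i.val = 0 ∧ j.val = 2) ∨ (j.val = 0 ∧ i.val = 2) then 3
        else (if i.val = 0 ∨ j.val = 0 then 2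
          else (if (j : ℕ) + 1 = i ∨ (i : ℕ) + 1 = j then 3 else 2)))
  isSymm := by unfold Matrix.IsSymm; aesop
  diagonal := by simp
  off_diagonal := by aesop

end ArtinTits

namespace BraidAux

section Refl
variable {G : Type*} [Group G] (x : ℕ → G)

/-- The reflection exchanging the strands `p` and `p + d + 1`. -/
def T (p : ℕ) : ℕ → G
  | 0 => x p
  | d + 1 => x (p + d + 1) * T p d * x (p + d + 1)

/-- The reflection exchanging the strands `p` and `q`. -/
def tt (p q : ℕ) : G := if p < q then T x p (q - p - 1) else T x q (p - q - 1)

structure Sys (N : ℕ) : Prop where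
  sq : ∀ i < N, x i * x i = 1
  comm : ∀ i j, i + 2 ≤ j → j < N → Commute (x i) (x j)
  braid : ∀ i, i + 1 < N → x i * x (i+1) * x i = x (i+1) * x i * x (i+1)

variable {x} {N : ℕ}

lemma T_far (h : Sys x N) (p d i : ℕ) (hd : p + d < N) (hi : i < N)
    (hc : i + 2 ≤ p ∨ p + d + 2 ≤ i) : Commute (x i) (T x p d) := by
  induction d with
  | zero =>
    rcases hc with hc | hc
    · exact h.comm _ _ hc (by omega)
    · exact (h.comm _ _ (by omega) hi).symm
  | succ d ih =>
    have h1 : Commute (x i) (x (p + d + 1)) := by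
      rcases hc with hc | hc
      · exact h.comm _ _ (by omega) (by omega)
      · exact (h.comm _ _ (by omega) hi).symm
    have h2 := ih (by omega) (by omega)
    exact (h1.mul_right h2).mul_right h1

lemma conj_eq_of_commute (h : Sys x N) {i : ℕ} (hi : i < N) {y : G} (hc : Commute (x i) y) :
    x i * y * x i = y := by
  rw [hc.eq, mul_assoc, h.sq i hi, mul_one]

lemma T_left (h : Sys x N) (i d : ℕ) (hd : i + 1 + d < N) :
    x i * T x (i+1) d * x i = T x i (d+1) := by
  induction d with
  | zero => simpa [T] using h.braid i (by omega)
  | succ d ih =>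
    have h1 : Commute (x i) (x (i + 1 + d + 1)) := h.comm _ _ (by omega) (by omega)
    have e : i + (d+1) + 1 = i + 1 + d + 1 := by omega
    rw [T, T, ← ih (by omega), e]
    calc _ = (x i * x (i + 1 + d + 1)) * T x (i+1) d * (x (i + 1 + d + 1) * x i) := by group
      _ = (x (i + 1 + d + 1) * x i) * T x (i+1) d * (x i * x (i + 1 + d + 1)) := by rw [h1.eq]
      _ = _ := by group

lemma T_mid (h : Sys x N) (p d i : ℕ) (hd : p + d < N) (h1 : p < i) (h2 : i < p + d) :
    Commute (x i) (T x p d) := by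
  induction d with
  | zero => omega
  | succ d ih =>
    by_cases hi : i < p + d
    · have h3 : Commute (x i) (x (p + d + 1)) := h.comm _ _ (by omega) (by omega)
      exact (h3.mul_right (ih (by omega) hi)).mul_right h3
    · obtain ⟨d, rfl⟩ : ∃ e, d = e + 1 := ⟨d - 1, by omega⟩
      obtain rfl : i = p + d + 1 := by omega
      have e : p + (d + 1) + 1 = p + d + 1 + 1 := by omega
      have hc : Commute (x (p + d + 1 + 1)) (T x p d) :=
        T_far h p d _ (by omega) (by omega) (by omega)
      have hb := h.braid (p + d + 1) (by omega)
      rw [T, T, e]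
      generalize x (p + d + 1) = a at *
      generalize x (p + d + 1 + 1) = b at *
      generalize T x p d = t at *
      show a * (b * (a * t * a) * b) = (b * (a * t * a) * b) * a
      calc a * (b * (a * t * a) * b) = (a * b * a) * t * a * b := by group
        _ = b * a * (b * t) * a * b := by rw [hb]; group
        _ = b * a * t * (b * a * b) := by rw [hc.eq]; group
        _ = _ := by rw [← hb]; group

lemma flip_conj (h : Sys x N) {i : ℕ} (hi : i < N) {y z : G} (e : x i * y * x i = z) :
    x i * z * x i = y := by
  rw [← e]
  calc _ = (x i * x i) * y * (x i * x i) := by group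
    _ = y := by rw [h.sq i hi]; simp

lemma tt_symm (p q : ℕ) (hpq : p ≠ q) : tt x p q = tt x q p := by
  unfold tt
  rcases lt_or_gt_of_ne hpq with h | h
  · rw [if_pos h, if_neg (by omega)]
  · rw [if_pos (h : q < p), if_neg (by omega)]

lemma tt_lt (h : Sys x N) (i p q : ℕ) (hi : i < N) (hq : q ≤ N) (hpq : p < q) :
    x i * tt x p q * x i = tt x (Equiv.swap i (i+1) p) (Equiv.swap i (i+1) q) := by
  have tl : ∀ p d, tt x p (p + d + 1) = T x p d := by
    intro p d
    unfold tt
    rw [if_pos (by omega)]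
    congr 1; omega
  obtain ⟨d, rfl⟩ : ∃ d, q = p + d + 1 := ⟨q - p - 1, by omega⟩
  rw [tl]
  have ne : ∀ y, y ≠ i → y ≠ i + 1 → Equiv.swap i (i+1) y = y :=
    fun y a b => Equiv.swap_apply_of_ne_of_ne a b
  by_cases c1 : i + 2 ≤ p ∨ p + d + 2 ≤ i
  · rw [conj_eq_of_commute h hi (T_far h p d i (by omega) hi c1), ne _ (by omega) (by omega),
      ne _ (by omega) (by omega), tl]
  by_cases c2 : p < i ∧ i < p + d
  · rw [conj_eq_of_commute h hi (T_mid h p d i (by omega) c2.1 c2.2), ne _ (by omega) (by omega),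
      ne _ (by omega) (by omega), tl]
  by_cases c3 : i + 1 = p
  · subst c3
    rw [T_left h i d (by omega), Equiv.swap_apply_right, ne _ (by omega) (by omega), ← tl]
    congr 1; omega
  by_cases c4 : i = p + d + 1
  · subst c4
    rw [Equiv.swap_apply_left, ne _ (by omega) (by omega)]
    exact (tl p (d+1)).symm
  by_cases c5 : i = p
  · subst c5
    rw [Equiv.swap_apply_left]
    cases d with
    | zero =>
      rw [show i + 0 + 1 = i + 1 by omega, Equiv.swap_apply_right, tt_symm _ _ (by omega)]
      rw [tl i 0]
      simp [T, h.sq i hi]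
    | succ d =>
      rw [ne _ (by omega) (by omega)]
      have := tl (i+1) d
      rw [show i + (d+1) + 1 = i + 1 + d + 1 by omega, this]
      exact flip_conj h hi (T_left h i d (by omega))
  · obtain ⟨e, rfl⟩ : ∃ e, d = e + 1 := ⟨d - 1, by omega⟩
    obtain rfl : i = p + e + 1 := by omega
    rw [show p + (e + 1) + 1 = p + e + 1 + 1 by omega, Equiv.swap_apply_right,
      ne _ (by omega) (by omega), tl]
    exact flip_conj h hi rfl

lemma tt_conj (h : Sys x N) (i p q : ℕ) (hi : i < N) (hp : p ≤ N) (hq : q ≤ N) (hpq : p ≠ q) :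
    x i * tt x p q * x i = tt x (Equiv.swap i (i+1) p) (Equiv.swap i (i+1) q) := by
  rcases lt_or_gt_of_ne hpq with h' | h'
  · exact tt_lt h i p q hi hq h'
  · rw [tt_symm p q hpq, tt_lt h i q p hi hp h', tt_symm]
    simpa using hpq.symm

lemma exists_lift (h : Sys x N) (τ : Equiv.Perm (Fin (N+1))) :
    ∃ v ∈ Subgroup.closure {y | ∃ i < N, y = x i}, ∀ p q : Fin (N+1), p ≠ q →
      v * tt x p q * v⁻¹ = tt x (τ p) (τ q) := by
  have hτ : τ ∈ Submonoid.closure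
      (Set.range fun i : Fin N ↦ Equiv.swap i.castSucc i.succ) := by
    rw [Equiv.Perm.mclosure_swap_castSucc_succ]; trivial
  induction hτ using Submonoid.closure_induction with
  | mem y hy =>
    obtain ⟨i, rfl⟩ := hy
    refine ⟨x i, Subgroup.subset_closure ⟨i, i.2, rfl⟩, fun p q hpq => ?_⟩
    have hinv : (x i)⁻¹ = x i := inv_eq_of_mul_eq_one_left (h.sq i i.2)
    rw [hinv, tt_conj h i p q i.2 (by omega) (by omega) (by simpa [Fin.ext_iff] using hpq)]
    have : ∀ r : Fin (N+1), Equiv.swap (i:ℕ) (i+1) r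
        = ((Equiv.swap i.castSucc i.succ r : Fin (N+1)) : ℕ) := by
      intro r
      simp only [Equiv.swap_apply_def, Fin.ext_iff, Fin.val_castSucc, Fin.val_succ]
      split_ifs <;> simp
    rw [this, this]
  | one => exact ⟨1, Subgroup.one_mem _, by simp⟩
  | mul a b _ _ ha hb =>
    obtain ⟨v, hv, hv'⟩ := ha
    obtain ⟨w, hw, hw'⟩ := hb
    refine ⟨v * w, Subgroup.mul_mem _ hv hw, fun p q hpq => ?_⟩
    have := hv' (b p) (b q) (by simpa using hpq)
    rw [Equiv.Perm.mul_apply, Equiv.Perm.mul_apply, ← this, ← hw' p q hpq]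
    group

lemma tt_succ (i : ℕ) : tt x i (i+1) = x i := by
  unfold tt; simp [T]

end Refl
end BraidAux
namespace ArtinTits
open BraidAux

lemma Bmat_far {n : ℕ} (i j : Fin n) (h : i.val + 2 ≤ j.val) : (Bmat n) i j = 2 := by
  show (if i = j then 1
      else (if (i.val = 0 ∧ j.val = 1) ∨ (j.val = 0 ∧ i.val = 1) then 4
        else (if (j : ℕ) + 1 = i ∨ (i : ℕ) + 1 = j then 3 else 2))) = 2
  rw [if_neg (by intro h'; subst h'; omega), if_neg (by omega), if_neg (by omega)]

lemma Bmat_three {n : ℕ} (i j : Fin n) (h0 : 1 ≤ i.val) (h : i.val + 1 = j.val) :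
    (Bmat n) i j = 3 := by
  show (if i = j then 1
      else (if (i.val = 0 ∧ j.val = 1) ∨ (j.val = 0 ∧ i.val = 1) then 4
        else (if (j : ℕ) + 1 = i ∨ (i : ℕ) + 1 = j then 3 else 2))) = 3
  rw [if_neg (by intro h'; subst h'; omega), if_neg (by omega), if_pos (by omega)]

lemma Bmat_four {n : ℕ} (i j : Fin n) (h0 : i.val = 0) (h : j.val = 1) :
    (Bmat n) i j = 4 := by
  show (if i = j then 1
      else (if (i.val = 0 ∧ j.val = 1) ∨ (j.val = 0 ∧ i.val = 1) then 4
        else (if (j : ℕ) + 1 = i ∨ (i : ℕ) + 1 = j then 3 else 2))) = 4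
  rw [if_neg (by intro h'; subst h'; omega), if_pos (by omega)]

lemma map_altProd {G H : Type*} [Monoid G] [Monoid H] (φ : G →* H) (a b : G) (m : ℕ) :
    φ (altProd a b m) = altProd (φ a) (φ b) m := by
  induction m generalizing a b with
  | zero => simp [altProd]
  | succ m ih => simp [altProd, ih]

/-- Case analysis on pairs of generators of `B_n`. -/
lemma Bmat_cases {n : ℕ} {p : Fin n → Fin n → ℕ → Prop} (hs : ∀ i j m, p i j m → p j i m)
    (h1 : ∀ i, p i i 1) (h2 : ∀ i j, i.val + 2 ≤ j.val → p i j 2)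
    (h3 : ∀ i j, 1 ≤ i.val → i.val + 1 = j.val → p i j 3)
    (h4 : ∀ i j, i.val = 0 → j.val = 1 → p i j 4) (i j : Fin n) : p i j (Bmat n i j) := by
  have key : ∀ i j : Fin n, i.val < j.val → p i j (Bmat n i j) := by
    intro i j hij
    by_cases a : i.val + 2 ≤ j.val
    · rw [Bmat_far i j a]; exact h2 i j a
    by_cases b : 1 ≤ i.val
    · rw [Bmat_three i j b (by omega)]; exact h3 i j b (by omega)
    · rw [Bmat_four i j (by omega) (by omega)]; exact h4 i j (by omega) (by omega)
  rcases lt_trichotomy i.val j.val with h | h | h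
  · exact key i j h
  · obtain rfl := Fin.ext h
    rw [(Bmat n).diagonal]; exact h1 i
  · rw [(Bmat n).symmetric]; exact hs _ _ _ (key j i h)

lemma artin_lift {n : ℕ} {G : Type*} [Group G] (f : Fin n → G)
    (h2 : ∀ i j, i.val + 2 ≤ j.val → f i * f j = f j * f i)
    (h3 : ∀ i j, 1 ≤ i.val → i.val + 1 = j.val → f i * f j * f i = f j * f i * f j)
    (h4 : ∀ i j, i.val = 0 → j.val = 1 → f i * f j * f i * f j = f j * f i * f j * f i) :
    ∃ φ : ArtinGroup (Bmat n) →* G, ∀ i, φ (σ (Bmat n) i) = f i := by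
  have hr : ∀ r ∈ artinRelationsSet (Bmat n), FreeGroup.lift f r = 1 := by
    rintro r ⟨i, j, -, rfl⟩
    rw [map_mul, map_inv, map_altProd, map_altProd, mul_inv_eq_one, FreeGroup.lift_apply_of,
      FreeGroup.lift_apply_of]
    revert i j
    refine Bmat_cases (p := fun i j m => altProd (f i) (f j) m = altProd (f j) (f i) m)
      (fun i j m h => h.symm) (fun i => rfl) ?_ ?_ ?_
    · intro i j h; simpa [altProd] using h2 i j h
    · intro i j h h'; simpa [altProd, mul_assoc] using h3 i j h h'
    · intro i j h h'; simpa [altProd, mul_assoc] using h4 i j h h'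
  exact ⟨PresentedGroup.toGroup hr, fun i => PresentedGroup.toGroup.of hr⟩

lemma sigma_rel {n : ℕ} (i j : Fin n) : altProd (σ (Bmat n) i) (σ (Bmat n) j) (Bmat n i j) =
    altProd (σ (Bmat n) j) (σ (Bmat n) i) (Bmat n i j) := by
  have h0 : Bmat n i j ≠ 0 :=
    Bmat_cases (p := fun _ _ m => m ≠ 0) (by simp) (by simp) (by simp) (by simp) (by simp) i j
  have hm : altProd (FreeGroup.of i) (FreeGroup.of j) (Bmat n i j) *
        (altProd (FreeGroup.of j) (FreeGroup.of i) (Bmat n i j))⁻¹ ∈ artinRelationsSet (Bmat n) :=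
    ⟨i, j, h0, rfl⟩
  have := PresentedGroup.one_of_mem hm
  rw [map_mul, map_inv, mul_inv_eq_one, map_altProd, map_altProd] at this
  exact this

lemma sigma_comm {n : ℕ} (i j : Fin n) (h : i.val + 2 ≤ j.val) :
    Commute (σ (Bmat n) i) (σ (Bmat n) j) := by
  have := sigma_rel i j
  rw [Bmat_far i j h] at this
  simp only [altProd, mul_one] at this
  exact this

lemma sigma_braid {n : ℕ} (i j : Fin n) (h0 : 1 ≤ i.val) (h : i.val + 1 = j.val) :
    σ (Bmat n) i * σ (Bmat n) j * σ (Bmat n) i = σ (Bmat n) j * σ (Bmat n) i * σ (Bmat n) j := by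
  have := sigma_rel i j
  rw [Bmat_three i j h0 h] at this
  simpa [altProd, mul_assoc] using this

/-- Permutations of the strands decorated by elements of `A`. -/
@[ext] structure Wr (A : Type*) where
  perm : Equiv.Perm ℕ
  val : ℕ → A

namespace Wr
variable {A : Type*} [Group A]

instance : Mul (Wr A) := ⟨fun a b => ⟨a.perm * b.perm, fun j => a.val (b.perm j) * b.val j⟩⟩
instance : One (Wr A) := ⟨⟨1, fun _ => 1⟩⟩
instance : Inv (Wr A) := ⟨fun a => ⟨a.perm⁻¹, fun j => (a.val (a.perm⁻¹ j))⁻¹⟩⟩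

lemma mul_perm (a b : Wr A) : (a * b).perm = a.perm * b.perm := rfl
lemma mul_val (a b : Wr A) (j : ℕ) : (a * b).val j = a.val (b.perm j) * b.val j := rfl
lemma one_perm : (1 : Wr A).perm = 1 := rfl
lemma one_val (j : ℕ) : (1 : Wr A).val j = 1 := rfl
lemma inv_perm (a : Wr A) : (a⁻¹).perm = a.perm⁻¹ := rfl
lemma inv_val (a : Wr A) (j : ℕ) : (a⁻¹).val j = (a.val (a.perm⁻¹ j))⁻¹ := rfl

instance : Group (Wr A) := Group.ofLeftAxioms
  (by
    intro a b c
    ext j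
    · rfl
    · simp [mul_val, mul_perm, mul_assoc])
  (by
    intro a
    ext j
    · rfl
    · simp [mul_val, one_val])
  (by
    intro a
    ext j
    · simp [mul_perm, inv_perm, one_perm]
    · simp [mul_val, inv_val, one_val])

end Wr

/-- The generators, indexed by natural numbers. -/
def ss (n : ℕ) (i : ℕ) : ArtinGroup (Bmat n) :=
  if h : 1 ≤ i ∧ i < n then σ (Bmat n) ⟨i, h.2⟩ else 1

lemma ss_comm (n : ℕ) (i j : ℕ) (h : i + 2 ≤ j) : Commute (ss n i) (ss n j) := by
  unfold ss
  split_ifs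
  · exact sigma_comm _ _ h
  all_goals simp

lemma ss_braid (n : ℕ) (i : ℕ) (h0 : 1 ≤ i) (h : i + 1 < n) :
    ss n i * ss n (i+1) * ss n i = ss n (i+1) * ss n i * ss n (i+1) := by
  unfold ss
  rw [dif_pos ⟨h0, by omega⟩, dif_pos ⟨by omega, h⟩]
  exact sigma_braid _ _ h0 rfl

/-- The result of deleting the strand `j` from the generator number `i`. -/
def del (n i j : ℕ) : ArtinGroup (Bmat n) :=
  if j + 1 < i then ss n (i - 1) else if j ≤ i then 1 else ss n i

/-- The decorated transposition attached to the generator number `i`. -/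
def EE (n i : ℕ) : Wr (ArtinGroup (Bmat n)) := ⟨Equiv.swap (i - 1) i, del n i⟩

lemma EE_comm (n i k : ℕ) (h : i + 2 ≤ k) (h0 : 1 ≤ i) : EE n i * EE n k = EE n k * EE n i := by
  ext j
  · simp only [Wr.mul_perm, EE, Equiv.Perm.mul_apply, Equiv.swap_apply_def]
    split_ifs <;> omega
  · simp only [Wr.mul_val, EE]
    have e1 : Equiv.swap (k-1) k j = if j = k - 1 then k else if j = k then k - 1 else j :=
      Equiv.swap_apply_def _ _ _
    have e2 : Equiv.swap (i-1) i j = if j = i - 1 then i else if j = i then i - 1 else j :=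
      Equiv.swap_apply_def _ _ _
    rw [e1, e2]
    unfold del
    have c1 := (ss_comm n i k h).eq
    have c2 : i + 2 ≤ k - 1 → ss n i * ss n (k-1) = ss n (k-1) * ss n i :=
      fun h => (ss_comm n i (k-1) h).eq
    have c3 := (ss_comm n (i-1) (k-1) (by omega)).eq
    split_ifs <;> first | omega | (simp <;> done) | exact c1 | exact c3 | exact c2 (by omega)

lemma EE_braid (n i : ℕ) (h0 : 1 ≤ i) (h : i + 1 < n) :
    EE n i * EE n (i+1) * EE n i = EE n (i+1) * EE n i * EE n (i+1) := by
  obtain ⟨i, rfl⟩ : ∃ k, i = k + 1 := ⟨i - 1, by omega⟩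
  have P : ∀ k j, (EE n k).perm j = if j = k - 1 then k else if j = k then k - 1 else j :=
    fun k j => Equiv.swap_apply_def _ _ _
  have V : ∀ k j, (EE n k).val j = del n k j := fun k j => rfl
  have hperm : (EE n (i+1) * EE n (i+1+1) * EE n (i+1)).perm =
      (EE n (i+1+1) * EE n (i+1) * EE n (i+1+1)).perm := by
    show Equiv.swap i (i+1) * Equiv.swap (i+1) (i+2) * Equiv.swap i (i+1) =
      Equiv.swap (i+1) (i+2) * Equiv.swap i (i+1) * Equiv.swap (i+1) (i+2)
    rw [Equiv.swap_mul_swap_mul_swap (by omega) (by omega), Equiv.swap_comm i (i+1),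
      Equiv.swap_comm (i+1) (i+2), Equiv.swap_mul_swap_mul_swap (by omega) (by omega),
      Equiv.swap_comm]
  refine Wr.ext hperm (funext fun j => ?_)
  · simp only [Wr.mul_val, Wr.mul_perm, Equiv.Perm.mul_apply, V]
    by_cases a : j < i
    · have q1 : (EE n (i+1)).perm j = j := by rw [P]; split_ifs <;> omega
      have q2 : (EE n (i+1+1)).perm j = j := by rw [P]; split_ifs <;> omega
      rw [q1, q2, q1]
      simp only [del]
      rw [if_pos (by omega), if_pos (by omega)]
      have := ss_braid n i (by omega) (by omega)
      simpa using this
    by_cases b : j = i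
    · subst b
      have q1 : (EE n (j+1)).perm j = j + 1 := by rw [P]; split_ifs <;> omega
      have q2 : (EE n (j+1+1)).perm j = j := by rw [P]; split_ifs <;> omega
      have q3 : (EE n (j+1+1)).perm (j+1) = j + 2 := by rw [P]; split_ifs <;> omega
      simp [q1, q2, q3, del]
    by_cases c : j = i + 1
    · subst c
      have q1 : (EE n (i+1)).perm (i+1) = i := by rw [P]; split_ifs <;> omega
      have q2 : (EE n (i+1+1)).perm i = i := by rw [P]; split_ifs <;> omega
      have q3 : (EE n (i+1+1)).perm (i+1) = i + 2 := by rw [P]; split_ifs <;> omega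
      have q4 : (EE n (i+1)).perm (i+2) = i + 2 := by rw [P]; split_ifs <;> omega
      simp [q1, q2, q3, q4, del]
    by_cases d : j = i + 2
    · subst d
      have q1 : (EE n (i+1)).perm (i+2) = i+2 := by rw [P]; split_ifs <;> omega
      have q2 : (EE n (i+1+1)).perm (i+2) = i+1 := by rw [P]; split_ifs <;> omega
      have q3 : (EE n (i+1)).perm (i+1) = i := by rw [P]; split_ifs <;> omega
      simp [q1, q2, q3, del]
    · have q1 : (EE n (i+1)).perm j = j := by rw [P]; split_ifs <;> omega
      have q2 : (EE n (i+1+1)).perm j = j := by rw [P]; split_ifs <;> omega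
      rw [q1, q2, q1]
      simp only [del]
      rw [if_neg (by omega), if_neg (by omega), if_neg (by omega), if_neg (by omega)]
      exact ss_braid n (i+1) h0 h

lemma exists_Phi (n : ℕ) : ∃ Φ : ArtinGroup (Bmat n) →* Wr (ArtinGroup (Bmat n)),
    ∀ i, 1 ≤ i → i < n → Φ (ss n i) = EE n i := by
  obtain ⟨Φ, h⟩ := artin_lift (n := n) (fun i => if i.val = 0 then 1 else EE n i.val)
    (by
      intro i j h
      by_cases hi : i.val = 0
      · simp [hi]
      · simp only [hi, if_false, show j.val ≠ 0 by omega]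
        exact EE_comm n _ _ h (by omega))
    (by
      intro i j h h'
      simp only [show i.val ≠ 0 by omega, if_false, show j.val ≠ 0 by omega]
      rw [← h']
      exact EE_braid n _ h (by omega))
    (by
      intro i j h h'
      simp [h])
  refine ⟨Φ, fun i h0 h1 => ?_⟩
  unfold ss
  rw [dif_pos ⟨h0, h1⟩, h]
  simp only [show i ≠ 0 by omega, if_false]

/-- The parabolic subgroup generated by the generators number `1, …, m`. -/
def PP (n m : ℕ) : Subgroup (ArtinGroup (Bmat n)) :=
  Subgroup.closure {y | ∃ i, 1 ≤ i ∧ i < n ∧ i ≤ m ∧ y = ss n i}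

lemma PP_mono (n : ℕ) {m m' : ℕ} (h : m ≤ m') : PP n m ≤ PP n m' := by
  apply Subgroup.closure_mono
  rintro y ⟨i, a, b, c, d⟩
  exact ⟨i, a, b, c.trans h, d⟩

lemma ss_mem_PP (n i m : ℕ) (h : i ≤ m) : ss n i ∈ PP n m := by
  by_cases h' : 1 ≤ i ∧ i < n
  · exact Subgroup.subset_closure ⟨i, h'.1, h'.2, h, rfl⟩
  · unfold ss; rw [dif_neg h']; exact Subgroup.one_mem _

lemma Phi_PP {n : ℕ} {Φ : ArtinGroup (Bmat n) →* Wr (ArtinGroup (Bmat n))}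
    (hΦ : ∀ i, 1 ≤ i → i < n → Φ (ss n i) = EE n i) (l : ℕ) (g : ArtinGroup (Bmat n))
    (hg : g ∈ PP n l) :
    (∀ j ≤ l, (Φ g).perm j ≤ l ∧ (Φ g).val j ∈ PP n (l-1)) ∧
    (∀ j, l < j → (Φ g).perm j = j ∧ (Φ g).val j = g) := by
  induction hg using Subgroup.closure_induction with
  | mem y hy =>
    obtain ⟨i, h0, h1, h2, rfl⟩ := hy
    rw [hΦ i h0 h1]
    have P : ∀ k j, (EE n k).perm j = if j = k - 1 then k else if j = k then k - 1 else j :=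
      fun k j => Equiv.swap_apply_def _ _ _
    have V : ∀ k j, (EE n k).val j = del n k j := fun k j => rfl
    refine ⟨fun j hj => ⟨?_, ?_⟩, fun j hj => ⟨?_, ?_⟩⟩
    · rw [P]; split_ifs <;> omega
    · rw [V]; unfold del
      split_ifs
      · exact ss_mem_PP _ _ _ (by omega)
      · exact Subgroup.one_mem _
      · exact ss_mem_PP _ _ _ (by omega)
    · rw [P]; split_ifs <;> omega
    · rw [V]; unfold del
      rw [if_neg (by omega), if_neg (by omega)]
  | one => simp [Wr.one_perm, Wr.one_val, Subgroup.one_mem]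
  | mul a b _ _ ha hb =>
    rw [map_mul]
    simp only [Wr.mul_perm, Wr.mul_val, Equiv.Perm.mul_apply]
    refine ⟨fun j hj => ?_, fun j hj => ?_⟩
    · have h1 := hb.1 j hj
      have h2 := ha.1 _ h1.1
      exact ⟨h2.1, Subgroup.mul_mem _ h2.2 h1.2⟩
    · have h1 := hb.2 j hj
      have h2 := ha.2 j hj
      rw [h1.1, h1.2, h2.1, h2.2]
      exact ⟨rfl, rfl⟩
  | inv a _ ha =>
    rw [map_inv]
    simp only [Wr.inv_perm, Wr.inv_val]
    refine ⟨fun j hj => ?_, fun j hj => ?_⟩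
    · have h1 : (Φ a).perm⁻¹ j ≤ l := by
        by_contra h
        have := (ha.2 _ (not_le.mp h)).1
        rw [show (Φ a).perm ((Φ a).perm⁻¹ j) = j from (Φ a).perm.apply_symm_apply j] at this
        omega
      exact ⟨h1, Subgroup.inv_mem _ (ha.1 _ h1).2⟩
    · have h1 := ha.2 j hj
      have h2 : (Φ a).perm⁻¹ j = j := by
        rw [Equiv.Perm.inv_eq_iff_eq, h1.1]
      rw [h2, h1.2]
      exact ⟨rfl, rfl⟩

/-- Removing the last strand: elements of `B_l` conjugate in `B_{m+1}` are conjugate in `B_m`. -/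
lemma remove_last (n l m : ℕ) (hlm : l ≤ m) (α β g : ArtinGroup (Bmat n)) (hα : α ∈ PP n l)
    (hβ : β ∈ PP n l) (hg : g ∈ PP n (m+1)) (h : α * g = g * β) :
    ∃ k ∈ PP n m, α * k = k * β := by
  obtain ⟨Φ, hΦ⟩ := exists_Phi n
  -- one-sided step
  have step : ∀ l, l ≤ m → ∀ α β g, α ∈ PP n l → β ∈ PP n l → g ∈ PP n (m+1) → α * g = g * β →
      ∃ k ∈ PP n m, ∃ α', α' * k = k * β ∧ (α' = α ∨ α' ∈ PP n (l-1)) := by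
    intro l hlm α β g hα hβ hg h
    have h1 := congrArg (fun z => (Φ z).val (m+1)) h
    simp only [map_mul, Wr.mul_val] at h1
    have h2 := (Phi_PP hΦ l β hβ).2 (m+1) (by omega)
    rw [h2.1, h2.2] at h1
    refine ⟨_, ((Phi_PP hΦ (m+1) g hg).1 (m+1) le_rfl).2, _, h1, ?_⟩
    by_cases hj : (Φ g).perm (m+1) ≤ l
    · exact Or.inr ((Phi_PP hΦ l α hα).1 _ hj).2
    · exact Or.inl ((Phi_PP hΦ l α hα).2 _ (not_le.mp hj)).2
  induction l generalizing α β g with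
  | zero =>
    have h0 : PP n 0 = ⊥ := by
      unfold PP
      rw [Subgroup.closure_eq_bot_iff]
      rintro y ⟨i, a, b, c, d⟩
      omega
    rw [h0, Subgroup.mem_bot] at hα hβ
    exact ⟨1, Subgroup.one_mem _, by simp [hα, hβ]⟩
  | succ l ih =>
    obtain ⟨k, hk, α', e1, c1⟩ := step _ hlm α β g hα hβ hg h
    rcases c1 with rfl | c1
    · exact ⟨k, hk, e1⟩
    have h' : β * g⁻¹ = g⁻¹ * α := by
      rw [eq_inv_mul_iff_mul_eq, ← mul_assoc, mul_inv_eq_iff_eq_mul, h]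
    obtain ⟨k', hk', β', e2, c2⟩ := step _ hlm β α g⁻¹ hβ hα (Subgroup.inv_mem _ hg) h'
    rcases c2 with rfl | c2
    · refine ⟨k'⁻¹, Subgroup.inv_mem _ hk', ?_⟩
      rw [eq_inv_mul_iff_mul_eq, ← mul_assoc, mul_inv_eq_iff_eq_mul, e2]
    have hkm := PP_mono n (Nat.le_succ m) hk
    have hkm' := PP_mono n (Nat.le_succ m) hk'
    have e3 : β' * (k' * g * k⁻¹) = (k' * g * k⁻¹) * α' := by
      calc β' * (k' * g * k⁻¹) = (β' * k') * g * k⁻¹ := by group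
        _ = k' * (α * g) * k⁻¹ := by rw [e2]; group
        _ = k' * g * (β * k⁻¹) := by rw [h]; group
        _ = k' * g * (k⁻¹ * (k * β) * k⁻¹) := by group
        _ = _ := by rw [← e1]; group
    obtain ⟨q, hq, e4⟩ := ih (by omega) β' α' _ c2 c1
      (Subgroup.mul_mem _ (Subgroup.mul_mem _ hkm' hg) (Subgroup.inv_mem _ hkm)) e3
    refine ⟨k'⁻¹ * q * k, Subgroup.mul_mem _ (Subgroup.mul_mem _ (Subgroup.inv_mem _ hk') hq) hk, ?_⟩
    calc α * (k'⁻¹ * q * k) = k'⁻¹ * (k' * α) * k'⁻¹ * q * k := by group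
      _ = k'⁻¹ * (β' * q) * k := by rw [← e2]; group
      _ = k'⁻¹ * q * (α' * k) := by rw [e4]; group
      _ = _ := by rw [e1]; group

lemma stable_PP (n l m : ℕ) (hlm : l ≤ m) (α β g : ArtinGroup (Bmat n)) (hα : α ∈ PP n l)
    (hβ : β ∈ PP n l) (hg : g ∈ PP n m) (h : α * g = g * β) :
    ∃ k ∈ PP n l, α * k = k * β := by
  induction m, hlm using Nat.le_induction generalizing g with
  | base => exact ⟨g, hg, h⟩
  | succ m hm ih =>
    obtain ⟨k, hk, e⟩ := remove_last n l m hm α β g hα hβ hg h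
    exact ih k hk e

/-- The product `s_1 ⋯ s_k`. -/
def dd (n : ℕ) : ℕ → ArtinGroup (Bmat n)
  | 0 => 1
  | k + 1 => dd n k * ss n (k+1)

lemma dd_mem (n k m : ℕ) (h : k ≤ m) : dd n k ∈ PP n m := by
  induction k with
  | zero => exact Subgroup.one_mem _
  | succ k ih => exact Subgroup.mul_mem _ (ih (by omega)) (ss_mem_PP _ _ _ h)

lemma dd_comm (n k i : ℕ) (h : k + 2 ≤ i) : Commute (dd n k) (ss n i) := by
  induction k with
  | zero => exact Commute.one_left _
  | succ k ih => exact (ih (by omega)).mul_left (ss_comm n _ _ h)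

lemma dd_shift (n k i : ℕ) (hk : k < n) (h0 : 1 ≤ i) (hi : i < k) :
    dd n k * ss n i = ss n (i+1) * dd n k := by
  induction k with
  | zero => omega
  | succ k ih =>
    by_cases h : i < k
    · rw [dd, mul_assoc, ← (ss_comm n i (k+1) (by omega)).eq, ← mul_assoc, ih (by omega) h,
        mul_assoc]
    · obtain rfl : i = k := by omega
      obtain ⟨i, rfl⟩ : ∃ j, i = j + 1 := ⟨i - 1, by omega⟩
      have hb := ss_braid n (i+1) h0 hk
      have hc := dd_comm n i (i+1+1) le_rfl
      rw [dd, dd]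
      calc _ = dd n i * (ss n (i+1) * ss n (i+1+1) * ss n (i+1)) := by group
        _ = (dd n i * ss n (i+1+1)) * ss n (i+1) * ss n (i+1+1) := by rw [hb]; group
        _ = _ := by rw [hc.eq]; group

lemma dd_pow_shift (n d i : ℕ) (h0 : 1 ≤ i) (hi : i + d < n) :
    dd n (n-1) ^ d * ss n i * (dd n (n-1) ^ d)⁻¹ = ss n (i+d) := by
  induction d with
  | zero => simp
  | succ d ih =>
    have h1 := dd_shift n (n-1) (i+d) (by omega) (by omega) (by omega)
    have h2 := ih (by omega)
    rw [mul_inv_eq_iff_eq_mul] at h2 ⊢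
    rw [pow_succ', mul_assoc, h2, ← mul_assoc, h1]
    group

/-- Conjugacy stability of the connected parabolic subgroups of type `A`. -/
lemma stable_interval (n a b : ℕ) (ha : 1 ≤ a) (hb : b < n)
    (α β g : ArtinGroup (Bmat n))
    (hα : α ∈ Subgroup.closure {y | ∃ i, a ≤ i ∧ i ≤ b ∧ y = ss n i})
    (hβ : β ∈ Subgroup.closure {y | ∃ i, a ≤ i ∧ i ≤ b ∧ y = ss n i})
    (hg : g ∈ PP n (n-1)) (h : α * g = g * β) :
    ∃ k ∈ Subgroup.closure {y | ∃ i, a ≤ i ∧ i ≤ b ∧ y = ss n i}, α * k = k * β := by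
  set c := dd n (n-1) ^ (a-1) with hc
  have hcm : c ∈ PP n (n-1) := Subgroup.pow_mem _ (dd_mem _ _ _ le_rfl) _
  have fwd : ∀ y ∈ Subgroup.closure {y | ∃ i, a ≤ i ∧ i ≤ b ∧ y = ss n i},
      c⁻¹ * y * c ∈ PP n (b + 1 - a) := by
    intro y hy
    induction hy using Subgroup.closure_induction with
    | mem y hy =>
      obtain ⟨i, h1, h2, rfl⟩ := hy
      have := dd_pow_shift n (a-1) (i - (a-1)) (by omega) (by omega)
      rw [show i - (a-1) + (a-1) = i by omega, ← hc] at this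
      rw [← this]
      have e : c⁻¹ * (c * ss n (i - (a-1)) * c⁻¹) * c = ss n (i - (a-1)) := by group
      rw [e]
      exact ss_mem_PP _ _ _ (by omega)
    | one => simp [Subgroup.one_mem]
    | mul x y _ _ hx hy =>
      have e : c⁻¹ * (x * y) * c = (c⁻¹ * x * c) * (c⁻¹ * y * c) := by group
      rw [e]; exact Subgroup.mul_mem _ hx hy
    | inv x _ hx =>
      have e : c⁻¹ * x⁻¹ * c = (c⁻¹ * x * c)⁻¹ := by group
      rw [e]; exact Subgroup.inv_mem _ hx
  have bwd : ∀ y ∈ PP n (b + 1 - a),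
      c * y * c⁻¹ ∈ Subgroup.closure {y | ∃ i, a ≤ i ∧ i ≤ b ∧ y = ss n i} := by
    intro y hy
    induction hy using Subgroup.closure_induction with
    | mem y hy =>
      obtain ⟨i, h1, h2, h3, rfl⟩ := hy
      rw [dd_pow_shift n (a-1) i (by omega) (by omega)]
      exact Subgroup.subset_closure ⟨_, by omega, by omega, rfl⟩
    | one => simp [Subgroup.one_mem]
    | mul x y _ _ hx hy =>
      have e : c * (x * y) * c⁻¹ = (c * x * c⁻¹) * (c * y * c⁻¹) := by group
      rw [e]; exact Subgroup.mul_mem _ hx hy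
    | inv x _ hx =>
      have e : c * x⁻¹ * c⁻¹ = (c * x * c⁻¹)⁻¹ := by group
      rw [e]; exact Subgroup.inv_mem _ hx
  obtain ⟨k, hk, e⟩ := stable_PP n (b + 1 - a) (n-1) (by omega) _ _ (c⁻¹ * g * c)
    (fwd α hα) (fwd β hβ)
    (Subgroup.mul_mem _ (Subgroup.mul_mem _ (Subgroup.inv_mem _ hcm) hg) hcm) (by
      calc _ = c⁻¹ * (α * g) * c := by group
        _ = _ := by rw [h]; group)
  refine ⟨_, bwd k hk, ?_⟩
  calc α * (c * k * c⁻¹) = c * ((c⁻¹ * α * c) * k) * c⁻¹ := by group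
    _ = _ := by rw [e]; group

end ArtinTits

namespace ArtinTits
open BraidAux

lemma exists_interval {n : ℕ} (Z : Set (Fin n)) (hZne : Z.Nonempty)
    (hZsub : ∀ z ∈ Z, 2 ≤ z.val) (hZconn : ConnectedIn (Bmat n) Z) :
    ∃ a b : ℕ, 2 ≤ a ∧ a ≤ b ∧ b < n ∧ ∀ i : Fin n, i ∈ Z ↔ a ≤ i.val ∧ i.val ≤ b := by
  obtain ⟨a, ha, ha'⟩ := Set.exists_min_image Z id (Set.toFinite Z) hZne
  obtain ⟨b, hb, hb'⟩ := Set.exists_max_image Z id (Set.toFinite Z) hZne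
  have key : ∀ c, ReachIn (Bmat n) Z a c → ∀ y : Fin n, a.val ≤ y.val → y.val ≤ c.val → y ∈ Z := by
    intro c hc
    induction hc with
    | refl =>
      intro y h1 h2
      have : y = a := Fin.ext (by omega)
      rwa [this]
    | tail _ hst ih =>
      rename_i p q _
      intro y h1 h2
      obtain ⟨hp, hq, hne, hM⟩ := hst
      by_cases hyp : y.val ≤ p.val
      · exact ih y h1 hyp
      · have : q.val ≤ p.val + 1 := by
          by_contra hlt
          exact hM (Bmat_far p q (by omega))
        have : y = q := Fin.ext (by omega)
        rwa [this]
  refine ⟨a, b, hZsub a ha, ha' b hb, b.2, fun i => ⟨fun hi => ⟨ha' i hi, hb' i hi⟩, fun hi => ?_⟩⟩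
  exact key b (hZconn a ha b hb) i hi.1 hi.2

/-- The permutation of the strands attached to a generator. -/
def perm0 {n : ℕ} (i : Fin n) : Equiv.Perm ℕ :=
  if i.val = 0 then 1 else Equiv.swap (i.val - 1) i.val

lemma perm0_liftable (n : ℕ) : (Bmat n).IsLiftable (perm0 (n := n)) := by
  have sq : ∀ i : Fin n, perm0 i * perm0 i = 1 := by
    intro i; unfold perm0; split_ifs <;> simp
  refine Bmat_cases (p := fun i j m => (perm0 i * perm0 j) ^ m = 1) ?_ ?_ ?_ ?_ ?_
  · intro i j m h
    have e : perm0 j * perm0 i = (perm0 i)⁻¹ * (perm0 i * perm0 j) * ((perm0 i)⁻¹)⁻¹ := by group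
    rw [e, conj_pow, h]; simp
  · intro i; rw [pow_one, sq]
  · intro i j h
    have hc : Commute (perm0 i) (perm0 j) := by
      unfold perm0
      rw [if_neg (show j.val ≠ 0 by omega)]
      split_ifs with h0
      · exact Commute.one_left _
      · ext x
        simp only [Equiv.Perm.mul_apply, Equiv.swap_apply_def]
        split_ifs <;> omega
    rw [hc.mul_pow, pow_two, pow_two, sq, sq, one_mul]
  · intro i j h h'
    have hb : perm0 i * perm0 j * perm0 i = perm0 j * perm0 i * perm0 j := by
      unfold perm0
      rw [if_neg (by omega), if_neg (by omega), ← h', Nat.add_sub_cancel]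
      obtain ⟨k, hk⟩ : ∃ k, i.val = k + 1 := ⟨i.val - 1, by omega⟩
      rw [hk, Nat.add_sub_cancel]
      rw [Equiv.swap_mul_swap_mul_swap (by omega) (by omega), Equiv.swap_comm k (k+1),
        Equiv.swap_comm (k+1) (k+1+1), Equiv.swap_mul_swap_mul_swap (by omega) (by omega),
        Equiv.swap_comm]
    calc (perm0 i * perm0 j) ^ 3
        = (perm0 i * perm0 j * perm0 i) * (perm0 j * perm0 i * perm0 j) := by
          simp only [pow_succ, pow_zero, one_mul, mul_assoc]
      _ = perm0 i * perm0 j * (perm0 i * perm0 i) * perm0 j * perm0 i := by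
          rw [← hb]; simp only [mul_assoc]
      _ = perm0 i * (perm0 j * perm0 j) * perm0 i := by
          rw [sq]; simp only [mul_assoc, one_mul, mul_one]
      _ = 1 := by rw [sq, mul_one, sq]
  · intro i j h h'
    have : perm0 i = 1 := by unfold perm0; rw [if_pos h]
    rw [this, one_mul, pow_succ, pow_succ, pow_two, sq, one_mul, sq]

lemma exists_perm (n : ℕ) : ∃ π : (Bmat n).Group →* Equiv.Perm ℕ,
    ∀ i, π ((Bmat n).simple i) = perm0 i :=
  ⟨(Bmat n).toCoxeterSystem.lift ⟨perm0, perm0_liftable n⟩,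
    fun i => (Bmat n).toCoxeterSystem.lift_apply_simple (perm0_liftable n) i⟩

lemma simple_sq' {n : ℕ} (i : Fin n) : (Bmat n).simple i * (Bmat n).simple i = 1 :=
  (Bmat n).toCoxeterSystem.simple_mul_simple_self i

lemma simple_pow {n : ℕ} (i j : Fin n) :
    ((Bmat n).simple i * (Bmat n).simple j) ^ (Bmat n i j) = 1 :=
  (Bmat n).toCoxeterSystem.simple_mul_simple_pow i j

lemma simple_inv' {n : ℕ} (i : Fin n) : ((Bmat n).simple i)⁻¹ = (Bmat n).simple i :=
  inv_eq_of_mul_eq_one_left (simple_sq' i)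

lemma simple_comm {n : ℕ} (i j : Fin n) (h : i.val + 2 ≤ j.val) :
    Commute ((Bmat n).simple i) ((Bmat n).simple j) := by
  have := simple_pow i j
  rw [Bmat_far i j h, pow_two, mul_eq_one_iff_eq_inv, mul_inv_rev, simple_inv', simple_inv'] at this
  exact this

lemma simple_braid {n : ℕ} (i j : Fin n) (h0 : 1 ≤ i.val) (h : i.val + 1 = j.val) :
    (Bmat n).simple i * (Bmat n).simple j * (Bmat n).simple i =
    (Bmat n).simple j * (Bmat n).simple i * (Bmat n).simple j := by
  have := simple_pow i j
  rw [Bmat_three i j h0 h] at this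
  have e : ((Bmat n).simple i * (Bmat n).simple j * (Bmat n).simple i) *
      ((Bmat n).simple j * (Bmat n).simple i * (Bmat n).simple j) = 1 := by
    rw [← this]; simp only [pow_succ, pow_zero, one_mul, mul_assoc]
  rw [mul_eq_one_iff_eq_inv, mul_inv_rev, mul_inv_rev, simple_inv', simple_inv'] at e
  rw [e, mul_assoc]

lemma swap_eq_swap {p q r t : ℕ} (hpq : p ≠ q) (h : Equiv.swap p q = Equiv.swap r t) :
    (p = r ∧ q = t) ∨ (p = t ∧ q = r) := by
  have h1 := congrArg (fun f => f p) h
  simp only [Equiv.swap_apply_left] at h1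
  rw [Equiv.swap_apply_def] at h1
  split_ifs at h1 with a b
  · exact Or.inl ⟨a, h1⟩
  · exact Or.inr ⟨b, h1⟩
  · exact absurd h1.symm hpq

lemma starW_aux (n : ℕ) (z0 : Fin n) (hz0 : z0.val = 0) (Z : Set (Fin n)) (a b : ℕ) (ha : 2 ≤ a)
    (hab : a ≤ b) (hb : b < n) (hZ : ∀ i : Fin n, i ∈ Z ↔ a ≤ i.val ∧ i.val ≤ b) :
    StarW (Bmat n) (insert z0 Z) := by
  intro Y₁ Y₂ hY₁ hY₂ w hw
  obtain ⟨π, hπ⟩ := exists_perm n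
  have hφ : ∀ y ∈ Y₁, ∃ z ∈ Y₂, w⁻¹ * (Bmat n).simple y * w = (Bmat n).simple z := by
    intro y hy
    have : w⁻¹ * (Bmat n).simple y * w ∈ (Bmat n).simple '' Y₂ := by
      rw [← hw]; exact ⟨_, ⟨y, hy, rfl⟩, rfl⟩
    obtain ⟨z, hz, e⟩ := this
    exact ⟨z, hz, e.symm⟩
  have hp0 : ∀ i : Fin n, perm0 i = 1 → i.val = 0 := by
    intro i h
    by_contra hne
    unfold perm0 at h
    rw [if_neg hne, Equiv.swap_eq_one_iff] at h
    omega
  set N := b + 1 - a with hN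
  let x : ℕ → (Bmat n).Group := fun i => if h : a + i < n then (Bmat n).simple ⟨a + i, h⟩ else 1
  have hx : ∀ i (h : a + i < n), x i = (Bmat n).simple ⟨a + i, h⟩ := fun i h => dif_pos h
  have hsys : Sys x N := by
    constructor
    · intro i hi
      rw [hx i (by omega)]; exact simple_sq' _
    · intro i j hij hj
      rw [hx i (by omega), hx j (by omega)]
      exact simple_comm _ _ (by show a + i + 2 ≤ a + j; omega)
    · intro i hi
      rw [hx i (by omega), hx (i+1) (by omega)]
      exact simple_braid _ _ (by show 1 ≤ a + i; omega) rfl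
  set ρ : Equiv.Perm ℕ := π w⁻¹ with hρ
  -- the action of `ρ` on the support of `Y₁`
  have hsupp : ∀ y ∈ Y₁, y.val ≠ 0 → ∃ z : Fin n, a ≤ z.val ∧ z.val ≤ b ∧
      w⁻¹ * (Bmat n).simple y * w = (Bmat n).simple z ∧
      ((ρ (y.val - 1) = z.val - 1 ∧ ρ y.val = z.val) ∨
       (ρ (y.val - 1) = z.val ∧ ρ y.val = z.val - 1)) := by
    intro y hy hy0
    obtain ⟨z, hz, e⟩ := hφ y hy
    have e1 := congrArg π e
    rw [map_mul, map_mul, hπ, hπ] at e1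
    have hw' : π w = ρ⁻¹ := by rw [hρ, map_inv, inv_inv]
    rw [hw', ← hρ] at e1
    have hz0' : z.val ≠ 0 := by
      intro h0
      have h1 : perm0 z = 1 := by unfold perm0; rw [if_pos h0]
      rw [h1, mul_inv_eq_one] at e1
      exact hy0 (hp0 y (by simpa using e1))
    have hzZ : z ∈ Z := by
      rcases hY₂ hz with h | h
      · exact absurd (h ▸ hz0) hz0'
      · exact h
    rw [hZ] at hzZ
    refine ⟨z, hzZ.1, hzZ.2, e, ?_⟩
    unfold perm0 at e1
    rw [if_neg hy0, if_neg hz0', ← Equiv.swap_apply_apply] at e1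
    exact swap_eq_swap (by intro h; have := ρ.injective h; omega) e1
  -- the support of `Y₁`, as a set of strands
  classical
  let U : Finset (Fin (N+1)) := Finset.univ.filter fun p =>
    ∃ y ∈ Y₁, y.val ≠ 0 ∧ (a - 1 + p.val = y.val - 1 ∨ a - 1 + p.val = y.val)
  have hU : ∀ p ∈ U, a - 1 ≤ ρ (a - 1 + p.val) ∧ ρ (a - 1 + p.val) ≤ b := by
    intro p hp
    obtain ⟨y, hy, hy0, h⟩ := (Finset.mem_filter.mp hp).2
    obtain ⟨z, h1, h2, -, h3⟩ := hsupp y hy hy0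
    rcases h with h | h <;> rw [h] <;> omega
  let f : Fin (N+1) → Fin (N+1) := fun p => Fin.ofNat (N+1) (ρ (a - 1 + p.val) - (a - 1))
  have hf : ∀ p ∈ U, a - 1 + (f p).val = ρ (a - 1 + p.val) := by
    intro p hp
    have := hU p hp
    have h2 : (f p).val = ρ (a - 1 + p.val) - (a - 1) := by
      show (ρ (a - 1 + p.val) - (a - 1)) % (N+1) = _
      exact Nat.mod_eq_of_lt (by omega)
    omega
  obtain ⟨g, hg⟩ := Finset.exists_equiv_extend_of_card_eq (α := Fin (N+1)) (β := Fin (N+1))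
    (t := Finset.univ) (by simp) (s := U) (f := f) (Finset.subset_univ _) (by
      intro p hp q hq hpq
      have h1 := hf p hp
      have h2 := hf q hq
      rw [hpq] at h1
      have := ρ.injective (h1.symm.trans h2)
      exact Fin.ext (by omega))
  let τ : Equiv.Perm (Fin (N+1)) := g.trans (Equiv.subtypeUnivEquiv (fun p => Finset.mem_univ p))
  have hτ : ∀ p ∈ U, τ p = f p := fun p hp => hg p hp
  obtain ⟨v, hv, hv'⟩ := exists_lift hsys τ
  have hsub : ({y | ∃ i < N, y = x i} : Set _) ⊆ (Bmat n).simple '' Z := by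
    rintro _ ⟨i, hi, rfl⟩
    rw [hx i (by omega)]
    exact ⟨_, (hZ _).2 ⟨by show a ≤ a + i; omega, by show a + i ≤ b; omega⟩, rfl⟩
  have hvZ : v ∈ Subgroup.closure ((Bmat n).simple '' Z) := Subgroup.closure_mono hsub hv
  have hcomm : ∀ u ∈ Subgroup.closure ((Bmat n).simple '' Z), Commute ((Bmat n).simple z0) u := by
    intro u hu
    induction hu using Subgroup.closure_induction with
    | mem y hy =>
      obtain ⟨i, hi, rfl⟩ := hy
      have := (hZ i).1 hi
      exact simple_comm _ _ (by omega)
    | one => exact Commute.one_right _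
    | mul _ _ _ _ h1 h2 => exact h1.mul_right h2
    | inv _ _ h1 => exact h1.inv_right
  refine ⟨v⁻¹, Subgroup.inv_mem _ (Subgroup.closure_mono
    (Set.image_mono (Set.subset_insert _ _)) hvZ), fun y hy => ?_⟩
  rw [inv_inv]
  by_cases hy0 : y.val = 0
  · obtain rfl : y = z0 := Fin.ext (by omega)
    rw [← (hcomm v hvZ).eq, mul_assoc, mul_inv_cancel, mul_one]
    obtain ⟨z, hz, e⟩ := hφ y hy
    have e1 := congrArg π e
    have h1 : perm0 y = 1 := by unfold perm0; rw [if_pos hy0]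
    rw [map_mul, map_mul, hπ, hπ, h1, mul_one, ← map_mul, inv_mul_cancel, map_one] at e1
    have := hp0 z e1.symm
    rw [e]
    congr 1
    exact Fin.ext (by omega)
  · obtain ⟨z, h1, h2, e, h3⟩ := hsupp y hy hy0
    have hyZ : a ≤ y.val ∧ y.val ≤ b := by
      rcases hY₁ hy with h | h
      · exact absurd (h ▸ hz0) hy0
      · exact (hZ y).1 h
    rw [e]
    have key : ∀ u : Fin n, a ≤ u.val → u.val ≤ b →
        (Bmat n).simple u = tt x (u.val - a) (u.val - a + 1) := by
      intro u hu hu'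
      rw [tt_succ, hx _ (by omega)]
      congr 1
      exact Fin.ext (by show u.val = a + (u.val - a); omega)
    let p : Fin (N+1) := ⟨y.val - a, by omega⟩
    let q : Fin (N+1) := ⟨y.val - a + 1, by omega⟩
    have hpq : p ≠ q := by
      intro h
      have : y.val - a = y.val - a + 1 := congrArg Fin.val h
      omega
    have hp : a - 1 + p.val = y.val - 1 := by show a - 1 + (y.val - a) = _; omega
    have hq : a - 1 + q.val = y.val := by show a - 1 + (y.val - a + 1) = _; omega
    have hpU : p ∈ U := Finset.mem_filter.mpr ⟨Finset.mem_univ _, y, hy, hy0, Or.inl hp⟩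
    have hqU : q ∈ U := Finset.mem_filter.mpr ⟨Finset.mem_univ _, y, hy, hy0, Or.inr hq⟩
    have h4 := hv' p q hpq
    have hfp := hf p hpU
    have hfq := hf q hqU
    rw [hp] at hfp
    rw [hq] at hfq
    rw [hτ p hpU, hτ q hqU] at h4
    rw [key y hyZ.1 hyZ.2, key z h1 h2]
    refine h4.trans ?_
    rcases h3 with ⟨h5, h6⟩ | ⟨h5, h6⟩
    · congr 1 <;> omega
    · rw [tt_symm _ _ (by omega)]
      congr 1 <;> omega

lemma stable_aux (n : ℕ) (z0 : Fin n) (hz0 : z0.val = 0) (Z : Set (Fin n)) (a b : ℕ) (ha : 2 ≤ a)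
    (hb : b < n) (hZ : ∀ i : Fin n, i ∈ Z ↔ a ≤ i.val ∧ i.val ≤ b) :
    IsConjugacyStable (AP (Bmat n) (insert z0 Z)) := by
  intro α β hα hβ ⟨g, hg⟩
  -- killing the first generator
  obtain ⟨r, hr⟩ := artin_lift (n := n) (fun i => ss n i.val)
    (fun i j h => (ss_comm n _ _ h).eq)
    (fun i j h h' => by rw [← h']; exact ss_braid n _ h (by omega))
    (fun i j h h' => by
      have : ss n i.val = 1 := by unfold ss; rw [dif_neg (by omega)]
      simp [this])
  -- counting the first generator
  obtain ⟨c, hc⟩ := artin_lift (n := n)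
    (fun i => if i.val = 0 then Multiplicative.ofAdd (1 : ℤ) else 1)
    (fun i j h => mul_comm _ _)
    (fun i j h h' => by
      simp [show i.val ≠ 0 by omega, show j.val ≠ 0 by omega])
    (fun i j h h' => by simp [h, h', mul_comm])
  set H := Subgroup.closure {y | ∃ i, a ≤ i ∧ i ≤ b ∧ y = ss n i} with hH
  have hcomm : ∀ u ∈ H, Commute (σ (Bmat n) z0) u := by
    intro u hu
    induction hu using Subgroup.closure_induction with
    | mem y hy =>
      obtain ⟨i, h1, h2, rfl⟩ := hy
      unfold ss
      rw [dif_pos ⟨by omega, by omega⟩]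
      exact sigma_comm _ _ (by show z0.val + 2 ≤ i; omega)
    | one => exact Commute.one_right _
    | mul _ _ _ _ h1 h2 => exact h1.mul_right h2
    | inv _ _ h1 => exact h1.inv_right
  have hHX : H ≤ AP (Bmat n) (insert z0 Z) := by
    rw [hH, Subgroup.closure_le]
    rintro _ ⟨i, h1, h2, rfl⟩
    unfold ss
    rw [dif_pos ⟨by omega, by omega⟩]
    exact Subgroup.subset_closure ⟨_, Or.inr ((hZ _).2 ⟨h1, h2⟩), rfl⟩
  have hdec : ∀ u ∈ AP (Bmat n) (insert z0 Z),
      r u ∈ H ∧ u = σ (Bmat n) z0 ^ (c u).toAdd * r u := by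
    intro u hu
    induction hu using Subgroup.closure_induction with
    | mem y hy =>
      obtain ⟨i, hi, rfl⟩ := hy
      rw [hr, hc]
      rcases hi with rfl | hi
      · have h1 : ss n i.val = 1 := by unfold ss; rw [dif_neg (by omega)]
        rw [h1, if_pos hz0]
        refine ⟨Subgroup.one_mem _, by simp⟩
      · have hi' := (hZ i).1 hi
        have h1 : ss n i.val = σ (Bmat n) i := by
          unfold ss; rw [dif_pos ⟨by omega, by omega⟩]
        rw [if_neg (by omega)]
        refine ⟨Subgroup.subset_closure ⟨_, hi'.1, hi'.2, rfl⟩, by simp [h1]⟩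
    | one => simp [Subgroup.one_mem]
    | mul x y _ _ hx hy =>
      rw [map_mul, map_mul]
      refine ⟨Subgroup.mul_mem _ hx.1 hy.1, ?_⟩
      have h1 := ((hcomm _ hx.1).zpow_left (c y).toAdd).eq
      rw [toAdd_mul, zpow_add]
      calc x * y = (σ (Bmat n) z0 ^ (c x).toAdd * r x) * (σ (Bmat n) z0 ^ (c y).toAdd * r y) := by
            rw [← hx.2, ← hy.2]
        _ = σ (Bmat n) z0 ^ (c x).toAdd * (r x * σ (Bmat n) z0 ^ (c y).toAdd) * r y := by
            simp only [mul_assoc]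
        _ = _ := by rw [← h1]; simp only [mul_assoc]
    | inv x _ hx =>
      rw [map_inv, map_inv]
      refine ⟨Subgroup.inv_mem _ hx.1, ?_⟩
      have h1 := ((hcomm _ hx.1).zpow_left (c x).toAdd).eq
      rw [toAdd_inv, zpow_neg, ← mul_inv_rev, ← h1, ← hx.2]
  have hrP : ∀ u, r u ∈ PP n (n-1) := by
    intro u
    have hu : u ∈ Subgroup.closure (Set.range (PresentedGroup.of (rels := artinRelationsSet (Bmat n)))) := by
      rw [PresentedGroup.closure_range_of]; trivial
    induction hu using Subgroup.closure_induction with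
    | mem y hy =>
      obtain ⟨i, rfl⟩ := hy
      have := hr i
      unfold σ at this
      rw [this]
      exact ss_mem_PP _ _ _ (by omega)
    | one => rw [map_one]; exact Subgroup.one_mem _
    | mul _ _ _ _ h1 h2 => rw [map_mul]; exact Subgroup.mul_mem _ h1 h2
    | inv _ _ h1 => rw [map_inv]; exact Subgroup.inv_mem _ h1
  have hg' : α * g = g * β := by rw [← hg]; group
  have e1 := congrArg r hg'
  rw [map_mul, map_mul] at e1
  have e2 := congrArg c hg'
  rw [map_mul, map_mul, mul_comm, mul_left_cancel_iff] at e2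
  obtain ⟨hα1, hα2⟩ := hdec α hα
  obtain ⟨hβ1, hβ2⟩ := hdec β hβ
  obtain ⟨k, hk, e3⟩ := stable_interval n a b (by omega) hb (r α) (r β) (r g) hα1 hβ1 (hrP g) e1
  refine ⟨k, hHX hk, ?_⟩
  have h1 := ((hcomm _ hk).zpow_left (c β).toAdd).eq
  rw [mul_assoc, inv_mul_eq_iff_eq_mul]
  rw [hα2, hβ2, e2, mul_assoc, e3, ← mul_assoc, h1, mul_assoc]

end ArtinTits

namespace ArtinTits

/-- Section 4.1 of the paper, case (a): in type `Bₙ` (`n ≥ 3`, vertices `0,…,n-1` standing for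
`s_1,…,s_n`, with `m_{s_1,s_2} = 4`), if `X = {s_1} ∪ Z` with `∅ ≠ Z ⊆ {s_3,…,s_n}` and the
induced Coxeter graph on `Z` connected, then `(W_X, W_S)` satisfies Property `⋆_W` and `A_X` is
conjugacy stable in `A_S`. -/
theorem Bn_case_starW_and_conjugacy_stable
    (n : ℕ) (hn : 3 ≤ n)
    (Z : Set (Fin n)) (hZne : Z.Nonempty) (hZsub : ∀ z ∈ Z, 2 ≤ z.val)
    (hZconn : ConnectedIn (Bmat n) Z) :
    StarW (Bmat n) (insert ⟨0, by omega⟩ Z) ∧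
    IsConjugacyStable (AP (Bmat n) (insert ⟨0, by omega⟩ Z)) := by
  obtain ⟨a, b, ha, hab, hb, hZ⟩ := exists_interval Z hZne hZsub hZconn
  exact ⟨starW_aux n _ rfl Z a b ha hab hb hZ, stable_aux n _ rfl Z a b ha hb hZ⟩

end ArtinTits
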